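/- Let ⋆ be a homogeneous preserving semistar operation on R and let V be a gr-valuation overring of R. Then V is a gr-⋆-valuation overring of R if and only if V is a gr-⋆_a-valuation overring of R. -/

import Mathlib

open Pointwise

section
/- `Γ` is a nonzero torsionless (i.e. admitting a compatible total order) cancellative
commutative monoid, `A` is an integral domain graded by `Γ` via `𝒜`, with quotient
field `K`. -/
variable {Γ : Type*} [AddCommMonoid Γ] [LinearOrder Γ]
  [CovariantClass Γ Γ (· + ·) (· < ·)] [Nontrivial Γ]
variable {A : Type*} [CommRing A] [IsDomain A]
variable {K : Type*} [Field K] [Algebra A K] [IsFractionRing A K]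

instance : SMulCommClass K A K := SMulCommClass.symm A K K

variable (𝒜 : Γ → AddSubgroup A) [GradedRing 𝒜]

/-- `a` is a nonzero homogeneous element of the graded domain `A`. -/
def IsHomog (a : A) : Prop := a ≠ 0 ∧ ∃ γ : Γ, a ∈ 𝒜 γ

/-- `x ∈ K` is a (nonzero) homogeneous element of the homogeneous quotient ring `R_H`,
i.e. `x = a/s` with `a` a nonzero homogeneous element and `s ∈ H`. -/
def IsHomogElem (x : K) : Prop :=
  ∃ a s : A, IsHomog 𝒜 a ∧ IsHomog 𝒜 s ∧ x * algebraMap A K s = algebraMap A K a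

/-- `x ∈ K` belongs to the homogeneous quotient ring `R_H`. -/
def MemRH (x : K) : Prop :=
  ∃ a s : A, IsHomog 𝒜 s ∧ x * algebraMap A K s = algebraMap A K a

/-- The image in `K` of an integral ideal of `A`. -/
def idealToK (I : Ideal A) : Submodule A K := Submodule.map (Algebra.linearMap A K) I

/-- `E` is a homogeneous fractional ideal of `A`: `sE` is (the image in `K` of) a
homogeneous integral ideal for some nonzero homogeneous `s`. -/
def IsHomogFrac (E : Submodule A K) : Prop :=
  ∃ s : A, IsHomog 𝒜 s ∧ ∃ I : Ideal A, Ideal.IsHomogeneous 𝒜 I ∧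
    algebraMap A K s • E = idealToK (K := K) I

/-- The four axioms of a semistar operation, imposed on nonzero `A`-submodules of `K`. -/
def IsSemistar (star : Submodule A K → Submodule A K) : Prop :=
  (∀ x : K, x ≠ 0 → ∀ E : Submodule A K, E ≠ ⊥ → star (x • E) = x • star E) ∧
  (∀ E F : Submodule A K, E ≠ ⊥ → E ≤ F → star E ≤ star F) ∧
  (∀ E : Submodule A K, E ≠ ⊥ → E ≤ star E) ∧
  (∀ E : Submodule A K, E ≠ ⊥ → star (star E) = star E)

/-- `star` is homogeneous preserving. -/
def HomogPres (star : Submodule A K → Submodule A K) : Prop :=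
  ∀ E : Submodule A K, E ≠ ⊥ → IsHomogFrac 𝒜 E → IsHomogFrac 𝒜 (star E)

/-- Membership in `E^{⋆_f} = ⋃ {F^⋆ : F nonzero finitely generated, F ⊆ E}`. -/
def MemStarF (star : Submodule A K → Submodule A K) (E : Submodule A K) (x : K) : Prop :=
  ∃ F : Submodule A K, F ≠ ⊥ ∧ F.FG ∧ F ≤ E ∧ x ∈ star F

/-- `star` is of finite type, i.e. `⋆ = ⋆_f`. -/
def IsFiniteType (star : Submodule A K → Submodule A K) : Prop :=
  ∀ E : Submodule A K, E ≠ ⊥ → ∀ x : K, x ∈ star E ↔ MemStarF star E x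

/-- Membership in `E^{⋆_a}`:  `F^{⋆_a} = ⋃ {((FG)^⋆ : G^⋆) : G nonzero f.g.}` for f.g. `F`,
and `E^{⋆_a} = ⋃ {F^{⋆_a} : F ⊆ E nonzero f.g.}`. -/
def MemStarA (star : Submodule A K → Submodule A K) (E : Submodule A K) (x : K) : Prop :=
  ∃ F : Submodule A K, F ≠ ⊥ ∧ F.FG ∧ F ≤ E ∧
    ∃ G : Submodule A K, G ≠ ⊥ ∧ G.FG ∧ ∀ y ∈ star G, x * y ∈ star (F * G)

/-- Membership in `E^{⋆_{a(h)}}`: as in `⋆_a` but with `G` ranging over nonzero finitely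
generated *homogeneous* fractional ideals. -/
def MemStarAH (star : Submodule A K → Submodule A K) (E : Submodule A K) (x : K) : Prop :=
  ∃ F : Submodule A K, F ≠ ⊥ ∧ F.FG ∧ F ≤ E ∧
    ∃ G : Submodule A K, G ≠ ⊥ ∧ G.FG ∧ IsHomogFrac 𝒜 G ∧ ∀ y ∈ star G, x * y ∈ star (F * G)

/-- `star` is graded-e.a.b. -/
def IsGrEab (star : Submodule A K → Submodule A K) : Prop :=
  ∀ E F G : Submodule A K,
    E ≠ ⊥ → E.FG → IsHomogFrac 𝒜 E →
    F ≠ ⊥ → F.FG → IsHomogFrac 𝒜 F →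
    G ≠ ⊥ → G.FG → IsHomogFrac 𝒜 G →
    star (E * F) ≤ star (E * G) → star F ≤ star G

/-- The `A`-submodule of `K` generated by all products `e * v`, `e ∈ E`, `v ∈ S`
(e.g. `EV` for an overring `V`). -/
def mulSet (E : Submodule A K) (S : Set K) : Submodule A K :=
  Submodule.span A {z : K | ∃ e ∈ E, ∃ v ∈ S, z = e * v}

/-- The `b`-operation: `E^b = ⋂ {EV : V a valuation overring of A}`. -/
def bOp : Submodule A K → Submodule A K := fun E =>
  ⨅ (V : ValuationSubring K) (_ : ∀ a : A, algebraMap A K a ∈ V), mulSet E (V : Set K)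

/-- The image of a polynomial over `A` in the rational function field `K(X)`. -/
noncomputable def polyToRatFunc (f : Polynomial A) : RatFunc K :=
  algebraMap (Polynomial K) (RatFunc K) (Polynomial.map (algebraMap A K) f)

/-- The content ideal `c(f)` of a polynomial. -/
def contentIdeal (f : Polynomial A) : Ideal A := Ideal.span (Set.range f.coeff)

/-- The homogeneous content ideal `𝒜_f`, generated by all homogeneous components of all
coefficients of `f`. -/
def homogContentIdeal (f : Polynomial A) : Ideal A :=
  Ideal.span {a : A | ∃ (n : ℕ) (γ : Γ), a = (DirectSum.decompose 𝒜 (f.coeff n) γ : A)}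

/-- The Kronecker function ring `Kr(R,⋆)` as a subset of `K(X)`. -/
def KrSet (star : Submodule A K → Submodule A K) : Set (RatFunc K) :=
  {q | ∃ f g h : Polynomial A, g ≠ 0 ∧ h ≠ 0 ∧
    q * polyToRatFunc (K := K) g = polyToRatFunc (K := K) f ∧
    idealToK (contentIdeal f * contentIdeal h) ≤ star (idealToK (contentIdeal g * contentIdeal h))}

/-- The homogeneous Kronecker function ring `KR(R,⋆)` as a subset of `K(X)`. -/
def KRSet (star : Submodule A K → Submodule A K) : Set (RatFunc K) :=
  {q | ∃ f g h : Polynomial A, g ≠ 0 ∧ h ≠ 0 ∧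
    q * polyToRatFunc (K := K) g = polyToRatFunc (K := K) f ∧
    idealToK (homogContentIdeal 𝒜 f * homogContentIdeal 𝒜 h) ≤
      star (idealToK (homogContentIdeal 𝒜 g * homogContentIdeal 𝒜 h))}

/-- `V` is a homogeneous overring of `A`: `R ⊆ V ⊆ R_H` and `V` is generated as an
additive group by its homogeneous elements. -/
def IsHomogOverring (V : Subring K) : Prop :=
  (∀ a : A, algebraMap A K a ∈ V) ∧ (∀ x ∈ V, MemRH 𝒜 x) ∧
  (∀ v ∈ V, v ∈ AddSubgroup.closure {x : K | x ∈ V ∧ IsHomogElem 𝒜 x})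

/-- `V` is a gr-valuation overring of `A`. -/
def IsGrValOverring (V : Subring K) : Prop :=
  IsHomogOverring 𝒜 V ∧ ∀ x : K, IsHomogElem 𝒜 x → x ∈ V ∨ x⁻¹ ∈ V

/-- `V` is a gr-`⋆`-valuation overring of `A`: `F^⋆ ⊆ FV` for every nonzero finitely
generated homogeneous fractional ideal `F`. -/
def IsGrStarValOverring (star : Submodule A K → Submodule A K) (V : Subring K) : Prop :=
  ∀ F : Submodule A K, F ≠ ⊥ → F.FG → IsHomogFrac 𝒜 F → star F ≤ mulSet F (V : Set K)

end

open AddMonoidAlgebra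

/-- In a unique factorization domain, `q ^ n ∣ p ^ n * c` for all `n` forces `q ∣ p`. -/
theorem dvd_of_forall_pow_dvd_pow_mul {D : Type*} [CommRing D] [IsDomain D]
    [UniqueFactorizationMonoid D] {p q c : D} (hc : c ≠ 0)
    (h : ∀ n : ℕ, q ^ n ∣ p ^ n * c) : q ∣ p := by
  classical
  by_cases hp : p = 0
  · simp [hp]
  by_cases hq : q = 0
  · have := h 1
    simp [hq, hp, hc] at this
  let := UniqueFactorizationMonoid.strongNormalizationMonoid (α := D)
  rw [UniqueFactorizationMonoid.dvd_iff_normalizedFactors_le_normalizedFactors hq hp,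
    Multiset.le_iff_count]
  intro a
  by_contra! hlt
  set n := Multiset.count a (UniqueFactorizationMonoid.normalizedFactors c) + 1 with hn
  have hdvd := h n
  rw [UniqueFactorizationMonoid.dvd_iff_normalizedFactors_le_normalizedFactors
    (pow_ne_zero _ hq) (mul_ne_zero (pow_ne_zero _ hp) hc),
    UniqueFactorizationMonoid.normalizedFactors_mul (pow_ne_zero _ hp) hc,
    UniqueFactorizationMonoid.normalizedFactors_pow,
    UniqueFactorizationMonoid.normalizedFactors_pow, Multiset.le_iff_count] at hdvd
  have := hdvd a
  simp only [Multiset.count_add, Multiset.count_nsmul] at this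
  nlinarith

/-- The exponent embedding `ℕ^σ → ℤ^σ`. -/
noncomputable def natToIntExponents (σ : Type*) : (σ →₀ ℕ) →+ (σ →₀ ℤ) :=
  Finsupp.mapRange.addMonoidHom (Nat.castAddMonoidHom ℤ)

theorem natToIntExponents_injective (σ : Type*) : Function.Injective (natToIntExponents σ) :=
  Finsupp.mapRange_injective _ (map_zero _) Nat.cast_injective

theorem uniqueFactorizationMonoid_laurent (K σ : Type*) [Field K] [Finite σ] :
    UniqueFactorizationMonoid (AddMonoidAlgebra K (σ →₀ ℤ)) := by
  classical
  let f : MvPolynomial σ K →+* AddMonoidAlgebra K (σ →₀ ℤ) :=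
    AddMonoidAlgebra.mapDomainRingHom K (natToIntExponents σ)
  let : Algebra (MvPolynomial σ K) (AddMonoidAlgebra K (σ →₀ ℤ)) := f.toAlgebra
  let M : Submonoid (MvPolynomial σ K) :=
    MonoidHom.mrange (MvPolynomial.monomialOneHom K σ)
  have hmon (d : σ →₀ ℕ) : f (MvPolynomial.monomial d 1) = single (natToIntExponents σ d) 1 :=
    AddMonoidAlgebra.mapDomain_single
  have hinj : Function.Injective f :=
    AddMonoidAlgebra.mapDomain_injective (natToIntExponents_injective σ)
  have : IsLocalization M (AddMonoidAlgebra K (σ →₀ ℤ)) := by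
    refine ⟨?_, ?_, ?_⟩
    · rintro ⟨_, d, rfl⟩
      refine IsUnit.of_mul_eq_one (single (-(natToIntExponents σ d.toAdd)) (1 : K)) ?_
      change f (MvPolynomial.monomial d.toAdd 1) * _ = _
      rw [hmon, single_mul_single]
      simp [one_def]
    · intro z
      induction z using AddMonoidAlgebra.induction_linear with
      | zero => exact ⟨(0, 1), by simp⟩
      | add x y hx hy =>
        obtain ⟨⟨a, s⟩, ha⟩ := hx
        obtain ⟨⟨b, t⟩, hb⟩ := hy
        refine ⟨(a * t + b * s, s * t), ?_⟩
        simp only [Submonoid.coe_mul, map_mul, map_add] at *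
        rw [← ha, ← hb]
        ring
      | single d r =>
        let e : σ →₀ ℕ := d.mapRange Int.toNat rfl
        let e' : σ →₀ ℕ := d.mapRange (fun z => (-z).toNat) rfl
        refine ⟨(MvPolynomial.monomial e r, ⟨MvPolynomial.monomial e' 1, .ofAdd e', rfl⟩), ?_⟩
        change single d r * f _ = f _
        rw [hmon, single_mul_single]
        have : f (MvPolynomial.monomial e r) = single (natToIntExponents σ e) r :=
          AddMonoidAlgebra.mapDomain_single
        rw [this, mul_one]
        congr 1
        ext i
        simp [natToIntExponents, e, e']
        omega
    · intro x y hxy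
      exact ⟨1, by rw [hinj hxy]⟩
  exact UniqueFactorizationMonoid.of_isLocalization M _

theorem uniqueFactorizationMonoid_groupAlgebra (K H : Type*) [Field K] [AddCommGroup H]
    [IsAddTorsionFree H] [AddGroup.FG H] :
    UniqueFactorizationMonoid (AddMonoidAlgebra K H) := by
  have : Module.Finite ℤ H := Module.Finite.iff_addGroup_fg.mpr inferInstance
  have := uniqueFactorizationMonoid_laurent K (Module.Free.ChooseBasisIndex ℤ H)
  exact (AddMonoidAlgebra.mapDomainRingEquiv K
    (Module.Free.chooseBasis ℤ H).repr.symm.toAddEquiv).toMulEquiv.uniqueFactorizationMonoid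
      inferInstance

/-- If `u` and `z` have exceptional exponents (those satisfying `PA` and `PB`), and all products of
coefficients other than the exceptional pairs lie in the groups `D`, then some coefficient of
`u * z` agrees modulo `D` with a single product of exceptional coefficients. -/
theorem exists_coeff_mul_sub_mem {K G : Type*} [CommRing K] [AddCommGroup G] [UniqueSums G]
    (D : G → AddSubgroup K) (u z : AddMonoidAlgebra K G) (PA PB : G → Prop)
    (hA : ∃ a ∈ u.coeff.support, PA a) (hB : ∃ b ∈ z.coeff.support, PB b)
    (h : ∀ a b, ¬ (PA a ∧ PB b) → u.coeff a * z.coeff b ∈ D (a + b)) :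
    ∃ a b, PA a ∧ PB b ∧ (u * z).coeff (a + b) - u.coeff a * z.coeff b ∈ D (a + b) := by
  classical
  obtain ⟨a, ha, b, hb, hab⟩ := UniqueSums.uniqueAdd_of_nonempty
    (A := u.coeff.support.filter PA) (B := z.coeff.support.filter PB)
    (by simpa [Finset.Nonempty] using hA) (by simpa [Finset.Nonempty] using hB)
  rw [Finset.mem_filter] at ha hb
  refine ⟨a, b, ha.2, hb.2, ?_⟩
  have hsum : (u * z).coeff (a + b) = ∑ p ∈ u.coeff.support ×ˢ z.coeff.support,
      if p.1 + p.2 = a + b then u.coeff p.1 * z.coeff p.2 else 0 := by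
    rw [coeff_mul, Finset.sum_product]
    rfl
  rw [hsum, ← Finset.add_sum_erase _ _ (Finset.mk_mem_product ha.1 hb.1)]
  simp only [if_true, add_sub_cancel_left]
  refine AddSubgroup.sum_mem _ fun p hp => ?_
  rw [Finset.mem_erase, Finset.mem_product] at hp
  split_ifs with he
  · rw [← he]
    refine h _ _ fun hP => hp.1 ?_
    have := hab (Finset.mem_filter.mpr ⟨hp.2.1, hP.1⟩) (Finset.mem_filter.mpr ⟨hp.2.2, hP.2⟩) he
    exact Prod.ext this.1 this.2
  · exact zero_mem _

/-- If `q * z` has coefficients in a family `D` of additive groups stable under multiplication by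
coefficients of `q ≠ 0` and under division by the nonzero ones, then so does `z`. -/
theorem coeff_mem_of_mul_coeff_mem {K G : Type*} [Field K] [AddCommGroup G] [UniqueSums G]
    (D : G → AddSubgroup K) (q z : AddMonoidAlgebra K G) (hq : q ≠ 0)
    (hmul : ∀ a b x, x ∈ D b → q.coeff a * x ∈ D (a + b))
    (hdiv : ∀ a b x, q.coeff a ≠ 0 → q.coeff a * x ∈ D (a + b) → x ∈ D b)
    (hqz : ∀ g, (q * z).coeff g ∈ D g) (g : G) : z.coeff g ∈ D g := by
  by_contra hg
  obtain ⟨a, b, ha, hb, hab⟩ := exists_coeff_mul_sub_mem D q z (fun a => q.coeff a ≠ 0)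
    (fun b => z.coeff b ∉ D b)
    (by
      obtain ⟨a, ha⟩ := Finsupp.support_nonempty_iff.mpr (coeff_eq_zero.not.mpr hq)
      exact ⟨a, ha, by simpa using ha⟩)
    ⟨g, Finsupp.mem_support_iff.mpr fun h0 => hg (h0 ▸ zero_mem _), hg⟩
    (by
      intro a b hn
      by_cases ha : q.coeff a = 0
      · simp [ha]
      · exact hmul _ _ _ (by by_contra hb; exact hn ⟨ha, hb⟩))
  refine hb (hdiv a b _ ha ?_)
  simpa using sub_mem (hqz (a + b)) hab

theorem groupAlgebra_dvd_of_forall_pow_dvd_pow_mul {K G : Type*} [Field K] [AddCommGroup G]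
    [IsAddTorsionFree G] [UniqueSums G] {p q c : AddMonoidAlgebra K G} (hc : c ≠ 0)
    (h : ∀ n : ℕ, q ^ n ∣ p ^ n * c) : q ∣ p := by
  classical
  obtain ⟨H, hfg, hpH, hqH, hcH⟩ : ∃ H : AddSubgroup G, AddGroup.FG H ∧
      (∀ g, p.coeff g ≠ 0 → g ∈ H) ∧ (∀ g, q.coeff g ≠ 0 → g ∈ H) ∧
      ∀ g, c.coeff g ≠ 0 → g ∈ H :=
    ⟨AddSubgroup.closure ((p.coeff.support ∪ q.coeff.support ∪ c.coeff.support : Finset G) : Set G),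
      AddGroup.closure_finset_fg _,
      fun g hg => AddSubgroup.subset_closure (by simp [hg]),
      fun g hg => AddSubgroup.subset_closure (by simp [hg]),
      fun g hg => AddSubgroup.subset_closure (by simp [hg])⟩
  have := uniqueFactorizationMonoid_groupAlgebra K H
  have : IsDomain (AddMonoidAlgebra K H) := { }
  let f : AddMonoidAlgebra K H →+* AddMonoidAlgebra K G :=
    AddMonoidAlgebra.mapDomainRingHom K H.subtype
  have hinj : Function.Injective f :=
    AddMonoidAlgebra.mapDomain_injective H.subtype_injective
  have hlift (z : AddMonoidAlgebra K G) (hz : ∀ g, z.coeff g ≠ 0 → g ∈ H) : ∃ w, f w = z := by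
    refine ⟨comapDomain _ H.subtype_injective z, mapDomain_comapDomain ?_ _⟩
    intro g hg
    exact ⟨⟨g, hz g (by simpa using hg)⟩, rfl⟩
  have hsub (w) (g : G) (hg : (f w).coeff g ≠ 0) : g ∈ H := by
    by_contra hn
    exact hg (Finsupp.mapDomain_of_notMem_range _ _ (by simpa using hn))
  obtain ⟨p, rfl⟩ := hlift p hpH
  obtain ⟨q, rfl⟩ := hlift q hqH
  obtain ⟨c, rfl⟩ := hlift c hcH
  have hc' : c ≠ 0 := by rintro rfl; simp at hc
  by_cases hq : q = 0
  · have := h 1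
    simp_all
  refine map_dvd f (dvd_of_forall_pow_dvd_pow_mul hc' fun n => ?_)
  obtain ⟨z, hz⟩ := h n
  let D : G → AddSubgroup K := fun g => if g ∈ H then ⊤ else ⊥
  have hD (g : G) (x : K) : x ∈ D g ↔ (x ≠ 0 → g ∈ H) := by
    by_cases hg : g ∈ H <;> simp [D, hg]
  have hz' : ∀ g, z.coeff g ∈ D g := by
    refine coeff_mem_of_mul_coeff_mem D (f (q ^ n)) z ?_ ?_ ?_ ?_
    · exact (map_ne_zero_iff f hinj).mpr (pow_ne_zero n hq)
    · intro a b x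
      simp only [hD]
      intro hx hne
      exact H.add_mem (hsub _ a (left_ne_zero_of_mul hne)) (hx (right_ne_zero_of_mul hne))
    · intro a b x ha
      simp only [hD]
      intro hx hne
      exact (H.add_mem_cancel_left (hsub _ a ha)).mp (hx (mul_ne_zero ha hne))
    · intro g
      rw [hD, map_pow, ← hz, ← map_pow, ← map_mul]
      exact hsub _ g
  obtain ⟨w, rfl⟩ := hlift z fun g => (hD g _).mp (hz' g)
  refine ⟨w, hinj ?_⟩
  simpa using hz

section HomogElem

variable {Γ : Type*} {A : Type*} [CommRing A] {K : Type*} [Field K] [Algebra A K]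
  {𝒜 : Γ → AddSubgroup A}

theorem IsHomogElem.ne_zero [IsFractionRing A K] {x : K} (hx : IsHomogElem 𝒜 x) : x ≠ 0 := by
  obtain ⟨a, s, ⟨ha, -⟩, -, h⟩ := hx
  rintro rfl
  rw [zero_mul] at h
  exact ha ((map_eq_zero_iff _ (IsFractionRing.injective A K)).mp h.symm)

theorem IsHomogElem.mul [AddCommMonoid Γ] [DecidableEq Γ] [IsDomain A] [GradedRing 𝒜]
    {x y : K} (hx : IsHomogElem 𝒜 x) (hy : IsHomogElem 𝒜 y) :
    IsHomogElem 𝒜 (x * y) := by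
  obtain ⟨a, s, ⟨ha, α, haα⟩, ⟨hs, β, hsβ⟩, h⟩ := hx
  obtain ⟨b, t, ⟨hb, γ, hbγ⟩, ⟨ht, δ, htδ⟩, h'⟩ := hy
  refine ⟨a * b, s * t, ⟨mul_ne_zero ha hb, _, SetLike.GradedMul.mul_mem haα hbγ⟩,
    ⟨mul_ne_zero hs ht, _, SetLike.GradedMul.mul_mem hsβ htδ⟩, ?_⟩
  rw [map_mul, map_mul, ← h, ← h']
  ring

theorem IsHomogElem.inv [IsFractionRing A K] {x : K} (hx : IsHomogElem 𝒜 x) :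
    IsHomogElem 𝒜 x⁻¹ := by
  have hx0 := hx.ne_zero
  obtain ⟨a, s, ha, hs, h⟩ := hx
  exact ⟨s, a, hs, ha, by rw [← h]; field_simp⟩

end HomogElem

section HomogeneousLocalization

variable {Γ : Type*} [AddCommMonoid Γ] [DecidableEq Γ]
variable {A : Type*} [CommRing A] {K : Type*} [Field K] [Algebra A K]
variable (𝒜 : Γ → AddSubgroup A) [GradedRing 𝒜]
variable {G : Type*} [AddCommGroup G] (ι : Γ →+ G)

/-- The ring homomorphism `∑ a_γ ↦ ∑ a_γ X^γ` from a graded ring to a group algebra. -/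
noncomputable def gradedToGroupAlgebra (K : Type*) [Field K] [Algebra A K] :
    A →+* AddMonoidAlgebra K G :=
  (DirectSum.toSemiring (A := fun i => 𝒜 i)
    (fun i => (singleAddHom (ι i)).comp ((algebraMap A K).toAddMonoidHom.comp (𝒜 i).subtype))
    (by simp [one_def])
    (by intro i j a b; simp [single_mul_single])).comp
    (DirectSum.decomposeRingEquiv 𝒜).toRingHom

/-- The sum of all coefficients of an element of a group algebra. -/
noncomputable def augmentation (K G : Type*) [Field K] [AddCommGroup G] :
    AddMonoidAlgebra K G →+* K :=
  (AddMonoidAlgebra.lift K K G 1).toRingHom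

@[simp]
theorem augmentation_single (K G : Type*) [Field K] [AddCommGroup G] (g : G) (x : K) :
    augmentation K G (single g x) = x := by
  simp [augmentation]

theorem gradedToGroupAlgebra_of_mem {γ : Γ} {a : A} (ha : a ∈ 𝒜 γ) :
    gradedToGroupAlgebra 𝒜 ι K a = single (ι γ) (algebraMap A K a) := by
  simp only [gradedToGroupAlgebra, RingHom.comp_apply]
  have : (DirectSum.decomposeRingEquiv 𝒜).toRingHom a = DirectSum.of (fun i => 𝒜 i) γ ⟨a, ha⟩ :=
    DirectSum.decompose_of_mem 𝒜 ha
  rw [this, DirectSum.toSemiring_of]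
  rfl

theorem augmentation_gradedToGroupAlgebra (a : A) :
    augmentation K G (gradedToGroupAlgebra 𝒜 ι K a) = algebraMap A K a := by
  induction a using DirectSum.Decomposition.inductionOn 𝒜 with
  | zero => simp
  | homogeneous a => rw [gradedToGroupAlgebra_of_mem 𝒜 ι a.2, augmentation_single]
  | add a b ha hb => simp [ha, hb]

theorem coeff_gradedToGroupAlgebra (hι : Function.Injective ι) (a : A) (γ : Γ) :
    (gradedToGroupAlgebra 𝒜 ι K a).coeff (ι γ) =
      algebraMap A K (DirectSum.decompose 𝒜 a γ : A) := by
  classical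
  induction a using DirectSum.Decomposition.inductionOn 𝒜 with
  | zero => simp
  | @homogeneous i a =>
    rw [gradedToGroupAlgebra_of_mem 𝒜 ι a.2, coeff_single, Finsupp.single_apply]
    by_cases h : i = γ
    · subst h
      simp
    · rw [if_neg (hι.ne h), DirectSum.decompose_of_mem_ne 𝒜 a.2 h, map_zero]
  | add a b ha hb => simp [ha, hb, DirectSum.decompose_add]

theorem single_coeff_gradedToGroupAlgebra_mem_range (a : A) (h : G) :
    single h ((gradedToGroupAlgebra 𝒜 ι K a).coeff h) ∈ (gradedToGroupAlgebra 𝒜 ι K).range := by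
  classical
  induction a using DirectSum.Decomposition.inductionOn 𝒜 with
  | zero => simp
  | @homogeneous i a =>
    rw [gradedToGroupAlgebra_of_mem 𝒜 ι a.2, coeff_single, Finsupp.single_apply]
    split_ifs with hi
    · exact ⟨a, by rw [gradedToGroupAlgebra_of_mem 𝒜 ι a.2, hi]⟩
    · simp
  | add a b ha hb => simpa [single_add] using add_mem ha hb

variable [IsFractionRing A K]

theorem exists_mem_of_gradedToGroupAlgebra_eq_single (hι : Function.Injective ι) {a : A}
    (ha : a ≠ 0) {h : G} {x : K} (hx : gradedToGroupAlgebra 𝒜 ι K a = single h x) :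
    ∃ γ, a ∈ 𝒜 γ ∧ ι γ = h := by
  classical
  have hinj := IsFractionRing.injective A K
  have key (γ : Γ) (hγ : (DirectSum.decompose 𝒜 a γ : A) ≠ 0) : ι γ = h := by
    by_contra hne
    refine hγ (hinj ?_)
    rw [← coeff_gradedToGroupAlgebra 𝒜 ι hι, hx, coeff_single, map_zero,
      Finsupp.single_apply, if_neg (Ne.symm hne)]
  have hsum := DirectSum.sum_support_decompose 𝒜 a
  obtain ⟨γ, hγ⟩ : ∃ γ, (DirectSum.decompose 𝒜 a γ : A) ≠ 0 := by
    by_contra! hall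
    exact ha (by rw [← hsum]; exact Finset.sum_eq_zero fun i _ => hall i)
  refine ⟨γ, ?_, key γ hγ⟩
  rw [← hsum]
  refine sum_mem fun i hi => ?_
  have hi' : (DirectSum.decompose 𝒜 a i : A) ≠ 0 := by simpa using hi
  obtain rfl : i = γ := hι ((key i hi').trans (key γ hγ).symm)
  exact SetLike.coe_mem _

variable [IsDomain A]

/-- The elements `∑ x_g X^g` of the group algebra over `K` with `x_g` homogeneous of degree `g` in
the localization of `A` at its nonzero homogeneous elements. -/
noncomputable def homogeneousLocalizationImage (K : Type*) [Field K] [Algebra A K]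
    [IsFractionRing A K] : Subring (AddMonoidAlgebra K G) where
  carrier := {z | ∃ s γ, s ≠ 0 ∧ s ∈ 𝒜 γ ∧
    single (ι γ) (algebraMap A K s) * z ∈ (gradedToGroupAlgebra 𝒜 ι K).range}
  zero_mem' := ⟨1, 0, one_ne_zero, SetLike.GradedOne.one_mem, by simp⟩
  one_mem' := ⟨1, 0, one_ne_zero, SetLike.GradedOne.one_mem, by simp [← one_def, one_mem]⟩
  neg_mem' := by
    rintro z ⟨s, γ, hs, hsγ, hz⟩
    exact ⟨s, γ, hs, hsγ, by simpa using hz⟩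
  add_mem' := by
    rintro z w ⟨s, γ, hs, hsγ, hz⟩ ⟨t, δ, ht, htδ, hw⟩
    refine ⟨s * t, γ + δ, mul_ne_zero hs ht, SetLike.GradedMul.mul_mem hsγ htδ, ?_⟩
    rw [← gradedToGroupAlgebra_of_mem 𝒜 ι hsγ] at hz
    rw [← gradedToGroupAlgebra_of_mem 𝒜 ι htδ] at hw
    rw [← gradedToGroupAlgebra_of_mem 𝒜 ι (SetLike.GradedMul.mul_mem hsγ htδ), map_mul]
    convert add_mem (mul_mem (RingHom.mem_range_self (gradedToGroupAlgebra 𝒜 ι K) t) hz)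
      (mul_mem (RingHom.mem_range_self (gradedToGroupAlgebra 𝒜 ι K) s) hw) using 1
    ring
  mul_mem' := by
    rintro z w ⟨s, γ, hs, hsγ, hz⟩ ⟨t, δ, ht, htδ, hw⟩
    refine ⟨s * t, γ + δ, mul_ne_zero hs ht, SetLike.GradedMul.mul_mem hsγ htδ, ?_⟩
    rw [← gradedToGroupAlgebra_of_mem 𝒜 ι hsγ] at hz
    rw [← gradedToGroupAlgebra_of_mem 𝒜 ι htδ] at hw
    rw [← gradedToGroupAlgebra_of_mem 𝒜 ι (SetLike.GradedMul.mul_mem hsγ htδ), map_mul]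
    convert mul_mem hz hw using 1
    ring

local notation "T" => homogeneousLocalizationImage 𝒜 ι K

theorem gradedToGroupAlgebra_mem (a : A) : gradedToGroupAlgebra 𝒜 ι K a ∈ T :=
  ⟨1, 0, one_ne_zero, SetLike.GradedOne.one_mem, by simp [← one_def]⟩

theorem eq_zero_of_augmentation_eq_zero [UniqueSums G] {z : AddMonoidAlgebra K G}
    (hz : z ∈ T) (h0 : augmentation K G z = 0) : z = 0 := by
  obtain ⟨s, γ, hs, hsγ, a, ha⟩ := hz
  have h := congrArg (augmentation K G) ha
  rw [augmentation_gradedToGroupAlgebra, map_mul, h0, mul_zero,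
    map_eq_zero_iff _ (IsFractionRing.injective A K)] at h
  rw [h, map_zero] at ha
  refine (mul_eq_zero.mp ha.symm).resolve_left ?_
  exact single_ne_zero.mpr ((map_ne_zero_iff _ (IsFractionRing.injective A K)).mpr hs)

theorem eq_of_augmentation_eq [UniqueSums G] {z w : AddMonoidAlgebra K G}
    (hz : z ∈ T) (hw : w ∈ T) (h : augmentation K G z = augmentation K G w) : z = w :=
  sub_eq_zero.mp (eq_zero_of_augmentation_eq_zero 𝒜 ι (sub_mem hz hw) (by simp [h]))

theorem single_coeff_mem {z : AddMonoidAlgebra K G} (hz : z ∈ T) (g : G) :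
    single g (z.coeff g) ∈ T := by
  obtain ⟨s, γ, hs, hsγ, a, ha⟩ := hz
  refine ⟨s, γ, hs, hsγ, ?_⟩
  have := single_coeff_gradedToGroupAlgebra_mem_range (K := K) 𝒜 ι a (ι γ + g)
  rw [ha, coeff_single_mul_apply] at this
  simpa [single_mul_single] using this

theorem isHomogElem_of_single_mem (hι : Function.Injective ι) {g : G} {x : K} (hx : x ≠ 0)
    (h : single g x ∈ T) : IsHomogElem 𝒜 x ∧ single (-g) x⁻¹ ∈ T := by
  obtain ⟨s, γ, hs, hsγ, a, ha⟩ := h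
  have hs' : algebraMap A K s ≠ 0 := (map_ne_zero_iff _ (IsFractionRing.injective A K)).mpr hs
  rw [single_mul_single] at ha
  have hax : algebraMap A K a = algebraMap A K s * x := by
    rw [← augmentation_gradedToGroupAlgebra 𝒜 ι, ha, augmentation_single]
  have ha0 : a ≠ 0 := by
    rintro rfl
    rw [map_zero] at hax
    exact mul_ne_zero hs' hx hax.symm
  obtain ⟨δ, haδ, hδ⟩ := exists_mem_of_gradedToGroupAlgebra_eq_single 𝒜 ι hι ha0 ha
  refine ⟨⟨a, s, ⟨ha0, δ, haδ⟩, ⟨hs, γ, hsγ⟩, by rw [hax, mul_comm]⟩, a, δ, ha0, haδ, s, ?_⟩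
  rw [gradedToGroupAlgebra_of_mem 𝒜 ι hsγ, single_mul_single, hδ, hax]
  congr 1
  · simp
  · field_simp

theorem IsHomogElem.exists_single_mem {x : K} (hx : IsHomogElem 𝒜 x) :
    ∃ g, single g x ∈ T := by
  obtain ⟨a, s, ⟨-, α, ha⟩, ⟨hs, β, hsβ⟩, h⟩ := hx
  refine ⟨ι α - ι β, s, β, hs, hsβ, a, ?_⟩
  rw [gradedToGroupAlgebra_of_mem 𝒜 ι ha, single_mul_single, ← h]
  congr 1
  · simp
  · ring

theorem MemRH.exists_augmentation_eq {x : K} (hx : MemRH 𝒜 x) :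
    ∃ z ∈ T, augmentation K G z = x := by
  obtain ⟨a, s, ⟨hs, β, hsβ⟩, h⟩ := hx
  have hs' : algebraMap A K s ≠ 0 := (map_ne_zero_iff _ (IsFractionRing.injective A K)).mpr hs
  refine ⟨single (-ι β) (algebraMap A K s)⁻¹ * gradedToGroupAlgebra 𝒜 ι K a,
    ⟨s, β, hs, hsβ, a, ?_⟩, ?_⟩
  · rw [← mul_assoc, single_mul_single]
    simp [hs', ← one_def]
  · rw [map_mul, augmentation_single, augmentation_gradedToGroupAlgebra, ← h]
    field_simp

/-- `R_H` is completely integrally closed in `K`. -/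
theorem exists_mem_augmentation_eq_of_forall_pow_mul [UniqueSums G] [IsAddTorsionFree G]
    (hι : Function.Injective ι) {y c : K} (hc : c ≠ 0) (h : ∀ n : ℕ, MemRH 𝒜 (y ^ n * c)) :
    ∃ z ∈ T, augmentation K G z = y := by
  obtain ⟨p, q, hq, rfl⟩ := IsFractionRing.div_surjective (A := A) y
  have hq0 : q ≠ 0 := nonZeroDivisors.ne_zero hq
  have hq' : algebraMap A K q ≠ 0 := (map_ne_zero_iff _ (IsFractionRing.injective A K)).mpr hq0
  set θ := gradedToGroupAlgebra 𝒜 ι K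
  have hθ (a : A) : θ a ∈ T := gradedToGroupAlgebra_mem 𝒜 ι a
  have hθq : θ q ≠ 0 := by
    intro h0
    have := augmentation_gradedToGroupAlgebra (K := K) 𝒜 ι q
    rw [h0, map_zero] at this
    exact hq' this.symm
  obtain ⟨zc, hzc, hc'⟩ := MemRH.exists_augmentation_eq 𝒜 ι (h 0)
  have hdvd : θ q ∣ θ p := by
    refine groupAlgebra_dvd_of_forall_pow_dvd_pow_mul (c := zc) ?_ fun n => ?_
    · rintro rfl
      simp at hc'
      exact hc hc'.symm
    · obtain ⟨w, hw, hw'⟩ := MemRH.exists_augmentation_eq 𝒜 ι (h n)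
      refine ⟨w, eq_of_augmentation_eq 𝒜 ι (mul_mem (pow_mem (hθ p) n) hzc)
        (mul_mem (pow_mem (hθ q) n) hw) ?_⟩
      simp only [map_mul, map_pow, hw', hc', θ, augmentation_gradedToGroupAlgebra, div_pow]
      field_simp
  obtain ⟨z, hz⟩ := hdvd
  let D : G → AddSubgroup K := fun g => (T).toAddSubgroup.comap (singleAddHom g)
  have hD (g : G) (x : K) : x ∈ D g ↔ single g x ∈ T := Iff.rfl
  have hzD : ∀ g, z.coeff g ∈ D g := by
    refine coeff_mem_of_mul_coeff_mem D (θ q) z hθq ?_ ?_ ?_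
    · intro a b x hx
      rw [hD] at hx ⊢
      rw [← single_mul_single]
      exact mul_mem (single_coeff_mem 𝒜 ι (hθ q) a) hx
    · intro a b x ha hx
      rw [hD] at hx ⊢
      have := mul_mem (isHomogElem_of_single_mem 𝒜 ι hι ha
        (single_coeff_mem 𝒜 ι (hθ q) a)).2 hx
      rwa [single_mul_single, neg_add_cancel_left, inv_mul_cancel_left₀ ha] at this
    · intro g
      rw [← hz]
      exact single_coeff_mem 𝒜 ι (hθ p) g
  refine ⟨z, ?_, ?_⟩
  · rw [← sum_coeff_single z]
    exact sum_mem fun g _ => hzD g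
  · have := congrArg (augmentation K G) hz
    simp only [map_mul, θ, augmentation_gradedToGroupAlgebra] at this
    rw [this]
    field_simp

end HomogeneousLocalization

section GrValuation

variable {Γ : Type*} [AddCommMonoid Γ] [DecidableEq Γ]
variable {A : Type*} [CommRing A] [IsDomain A] {K : Type*} [Field K] [Algebra A K]
variable [IsFractionRing A K]
variable {𝒜 : Γ → AddSubgroup A} [GradedRing 𝒜] {V : Subring K}
variable {G : Type*} [AddCommGroup G] {ι : Γ →+ G}

local notation "T" => homogeneousLocalizationImage 𝒜 ι K

theorem IsGrValOverring.exists_forall_div_mem (hV : IsGrValOverring 𝒜 V) (s : Finset K)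
    (hs : s.Nonempty) (hhom : ∀ x ∈ s, IsHomogElem 𝒜 x) :
    ∃ f ∈ s, ∀ x ∈ s, x * f⁻¹ ∈ V := by
  classical
  induction hs using Finset.Nonempty.cons_induction with
  | singleton a =>
    refine ⟨a, by simp, fun x hx => ?_⟩
    obtain rfl := Finset.mem_singleton.mp hx
    rw [mul_inv_cancel₀ (hhom x hx).ne_zero]
    exact one_mem V
  | cons a s has hs ih =>
    obtain ⟨f, hf, hmax⟩ := ih fun x hx => hhom x (Finset.mem_cons_of_mem hx)
    have ha := hhom a (Finset.mem_cons_self a s)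
    have hf' := hhom f (Finset.mem_cons_of_mem hf)
    rcases hV.2 _ (ha.mul hf'.inv) with h | h
    · refine ⟨f, Finset.mem_cons_of_mem hf, fun x hx => ?_⟩
      rcases Finset.mem_cons.mp hx with rfl | hx
      exacts [h, hmax x hx]
    · refine ⟨a, Finset.mem_cons_self a s, fun x hx => ?_⟩
      rcases Finset.mem_cons.mp hx with rfl | hx
      · rw [mul_inv_cancel₀ ha.ne_zero]
        exact one_mem V
      · convert V.mul_mem (hmax x hx) h using 1
        field_simp [ha.ne_zero, hf'.ne_zero]

theorem IsGrValOverring.exists_coeff_mem (hV : IsGrValOverring 𝒜 V) {v : K} (hv : v ∈ V) :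
    ∃ z ∈ T, (∀ g, z.coeff g ∈ V) ∧ augmentation K G z = v := by
  classical
  have hcl := hV.1.2.2 v hv
  clear hv
  induction hcl using AddSubgroup.closure_induction with
  | mem x hx =>
    obtain ⟨g, hg⟩ := hx.2.exists_single_mem 𝒜 ι
    refine ⟨single g x, hg, fun h => ?_, augmentation_single ..⟩
    rw [coeff_single, Finsupp.single_apply]
    split_ifs
    exacts [hx.1, zero_mem V]
  | zero => exact ⟨0, zero_mem _, by simp [zero_mem], by simp⟩
  | add x y _ _ hx hy =>
    obtain ⟨z, hz, hzV, rfl⟩ := hx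
    obtain ⟨w, hw, hwV, rfl⟩ := hy
    exact ⟨z + w, add_mem hz hw, fun g => add_mem (hzV g) (hwV g), map_add ..⟩
  | neg x _ hx =>
    obtain ⟨z, hz, hzV, rfl⟩ := hx
    exact ⟨-z, neg_mem hz, fun g => by simpa using hzV g, map_neg ..⟩

theorem augmentation_mem {z : AddMonoidAlgebra K G} (hz : ∀ g, z.coeff g ∈ V) :
    augmentation K G z ∈ V := by
  rw [← sum_coeff_single z, Finsupp.sum, map_sum]
  exact sum_mem fun g _ => by simpa using hz g

variable (𝒜 ι V) in
/-- The homogeneous elements of degree `g` of `V` that are zero or not invertible in `V`. -/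
def grNonunits (hι : Function.Injective ι) (hV : IsGrValOverring 𝒜 V) (g : G) :
    AddSubgroup K where
  carrier := {x | single g x ∈ T ∧ x ∈ V ∧ (x⁻¹ ∈ V → x = 0)}
  zero_mem' := ⟨by simp [zero_mem], zero_mem V, fun _ => rfl⟩
  neg_mem' := by
    rintro x ⟨hT, hxV, hx⟩
    refine ⟨by simpa using neg_mem hT, neg_mem hxV, fun h => ?_⟩
    rw [hx (by simpa [inv_neg] using h), neg_zero]
  add_mem' := by
    rintro x y ⟨hxT, hxV, hx⟩ ⟨hyT, hyV, hy⟩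
    refine ⟨by simpa [single_add] using add_mem hxT hyT, add_mem hxV hyV, fun h => ?_⟩
    by_contra hxy
    by_cases hx0 : x = 0
    · subst hx0
      rw [zero_add] at h hxy
      exact hxy (hy h)
    by_cases hy0 : y = 0
    · subst hy0
      rw [add_zero] at h hxy
      exact hxy (hx h)
    have hxh := (isHomogElem_of_single_mem 𝒜 ι hι hx0 hxT).1
    have hyh := (isHomogElem_of_single_mem 𝒜 ι hι hy0 hyT).1
    rcases hV.2 _ (hxh.mul hyh.inv) with h' | h'
    · refine hy0 (hy ?_)
      convert V.mul_mem (add_mem h' (one_mem V)) h using 1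
      field_simp
    · refine hx0 (hx ?_)
      convert V.mul_mem (add_mem h' (one_mem V)) h using 1
      field_simp
      ring

/-- Gauss's lemma for a gr-valuation overring. -/
theorem IsGrValOverring.coeff_mem_of_mul_coeff_mem [UniqueSums G] (hι : Function.Injective ι)
    (hV : IsGrValOverring 𝒜 V) {u z : AddMonoidAlgebra K G} (hu : u ∈ T) (hz : z ∈ T)
    (huV : ∀ g, u.coeff g ∈ V) (hu1 : ∃ g, u.coeff g = 1)
    (huz : ∀ g, (u * z).coeff g ∈ V) (g : G) : z.coeff g ∈ V := by
  classical
  by_cases hz0 : z = 0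
  · simp [hz0, zero_mem]
  have hhom (h : G) (hh : z.coeff h ≠ 0) :=
    isHomogElem_of_single_mem 𝒜 ι hι hh (single_coeff_mem 𝒜 ι hz h)
  obtain ⟨f, hf, hmax⟩ := hV.exists_forall_div_mem (z.coeff.support.image z.coeff)
    ((Finsupp.support_nonempty_iff.mpr (coeff_eq_zero.not.mpr hz0)).image _)
    (by
      intro x hx
      obtain ⟨h, hh, rfl⟩ := Finset.mem_image.mp hx
      exact (hhom h (by simpa using hh)).1)
  obtain ⟨k, hk, rfl⟩ := Finset.mem_image.mp hf
  have hk0 : z.coeff k ≠ 0 := by simpa using hk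
  have hmax' (h : G) : z.coeff h * (z.coeff k)⁻¹ ∈ V := by
    by_cases hh : z.coeff h = 0
    · simp [hh, zero_mem]
    · exact hmax _ (Finset.mem_image_of_mem _ (by simpa using hh))
  set w := single (-k) (z.coeff k)⁻¹ * z with hw
  have hwT : w ∈ T := mul_mem (hhom k hk0).2 hz
  have hwc (h : G) : w.coeff h = z.coeff (k + h) * (z.coeff k)⁻¹ := by
    rw [hw, coeff_single_mul_apply, neg_neg, mul_comm]
  have hwV (h : G) : w.coeff h ∈ V := hwc h ▸ hmax' _
  have huw (h : G) : (u * w).coeff h = (u * z).coeff (k + h) * (z.coeff k)⁻¹ := by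
    rw [hw, mul_left_comm, coeff_single_mul_apply, neg_neg, mul_comm]
  let M := grNonunits 𝒜 V ι hι hV
  have hM (h : G) (x : K) : x ∈ M h ↔ single h x ∈ T ∧ x ∈ V ∧ (x⁻¹ ∈ V → x = 0) := Iff.rfl
  have hone (h : G) : (1 : K) ∉ M h := fun h1 => one_ne_zero (h1.2.2 (by simp [one_mem]))
  have hmulM {a b : G} {x y : K} (hx : x ∈ M a) (hyT : single b y ∈ T) (hyV : y ∈ V) :
      x * y ∈ M (a + b) := by
    refine ⟨by simpa [single_mul_single] using mul_mem hx.1 hyT, mul_mem hx.2.1 hyV, fun h => ?_⟩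
    by_cases hy : y = 0
    · simp [hy]
    rw [hx.2.2 ?_, zero_mul]
    convert mul_mem hyV h using 1
    field_simp
  have huM (a : G) : u.coeff a ∉ M a → (u.coeff a)⁻¹ ∈ V := by
    rw [hM]
    have := single_coeff_mem 𝒜 ι hu a
    have := huV a
    tauto
  have hwM (a : G) : w.coeff a ∉ M a → (w.coeff a)⁻¹ ∈ V := by
    rw [hM]
    have := single_coeff_mem 𝒜 ι hwT a
    have := hwV a
    tauto
  obtain ⟨a, b, ha, hb, hab⟩ := exists_coeff_mul_sub_mem M u w (fun a => u.coeff a ∉ M a)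
    (fun b => w.coeff b ∉ M b)
    (by
      obtain ⟨a, ha⟩ := hu1
      exact ⟨a, by simp [ha], ha ▸ hone a⟩)
    (by
      have : w.coeff 0 = 1 := by rw [hwc, add_zero, mul_inv_cancel₀ hk0]
      exact ⟨0, by simp [this], this ▸ hone 0⟩)
    (by
      intro a b hn
      by_cases ha : u.coeff a ∈ M a
      · exact hmulM ha (single_coeff_mem 𝒜 ι hwT b) (hwV b)
      · have hb : w.coeff b ∈ M b := by
          by_contra hb
          exact hn ⟨ha, hb⟩
        rw [mul_comm, add_comm]
        exact hmulM hb (single_coeff_mem 𝒜 ι hu a) (huV a))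
  have hkV : z.coeff k ∈ V := by
    by_contra hkV
    have hu0 : u.coeff a ≠ 0 := fun h0 => ha (h0 ▸ zero_mem _)
    have hw0 : w.coeff b ≠ 0 := fun h0 => hb (h0 ▸ zero_mem _)
    have hmem : (u * w).coeff (a + b) ∈ M (a + b) := by
      refine ⟨single_coeff_mem 𝒜 ι (mul_mem hu hwT) _, ?_, fun h => ?_⟩
      · have := add_mem hab.2.1 (mul_mem (huV a) (hwV b))
        rwa [sub_add_cancel] at this
      · by_contra hne
        refine hkV ?_
        rw [huw] at h hne
        convert mul_mem (huz (k + (a + b))) h using 1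
        have := left_ne_zero_of_mul hne
        field_simp
    have hprod : u.coeff a * w.coeff b ∈ M (a + b) := by simpa using sub_mem hmem hab
    refine mul_ne_zero hu0 hw0 (hprod.2.2 ?_)
    rw [mul_inv]
    exact mul_mem (huM a ha) (hwM b hb)
  convert mul_mem (hmax' g) hkV using 1
  field_simp

end GrValuation

section Semistar

variable {A : Type*} [CommRing A] {K : Type*} [Field K] [Algebra A K]

theorem Submodule.mul_ne_bot_of_field {E F : Submodule A K} (hE : E ≠ ⊥) (hF : F ≠ ⊥) :
    E * F ≠ ⊥ := by
  obtain ⟨e, he, he0⟩ := E.ne_bot_iff.mp hE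
  obtain ⟨f, hf, hf0⟩ := F.ne_bot_iff.mp hF
  exact (Submodule.ne_bot_iff _).mpr ⟨e * f, Submodule.mul_mem_mul he hf, mul_ne_zero he0 hf0⟩

theorem mem_mulSet_mul_mem {V : Subring K} (hA : ∀ a : A, algebraMap A K a ∈ V)
    {E : Submodule A K} {r : K} (hE : ∀ e ∈ E, e * r ∈ V) {x : K}
    (hx : x ∈ mulSet E (V : Set K)) : x * r ∈ V := by
  induction hx using Submodule.span_induction with
  | mem x hx =>
    obtain ⟨e, he, v, hv, rfl⟩ := hx
    rw [mul_right_comm]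
    exact mul_mem (hE e he) hv
  | zero => simp [zero_mem]
  | add x y _ _ hx hy => simpa [add_mul] using add_mem hx hy
  | smul a x _ hx =>
    rw [Algebra.smul_def, mul_assoc]
    exact mul_mem (hA a) hx

theorem mul_mem_mulSet {V : Subring K} {E : Submodule A K} {e v : K} (he : e ∈ E) (hv : v ∈ V) :
    e * v ∈ mulSet E (V : Set K) :=
  Submodule.subset_span ⟨e, he, v, hv, rfl⟩

variable {star : Submodule A K → Submodule A K}

theorem IsSemistar.mul_mem (hstar : IsSemistar star) {M N : Submodule A K} (hN : N ≠ ⊥) {x : K}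
    (h : ∀ w ∈ N, x * w ∈ star M) (hM : M ≠ ⊥) {w : K} (hw : w ∈ star N) :
    x * w ∈ star M := by
  by_cases hx : x = 0
  · simp [hx]
  have hle : x • N ≤ star M := by
    rintro _ ⟨w, hw, rfl⟩
    exact h w hw
  have hne : x • N ≠ ⊥ := by
    obtain ⟨n, hn, hn0⟩ := N.ne_bot_iff.mp hN
    exact (Submodule.ne_bot_iff _).mpr
      ⟨x * n, Submodule.smul_mem_pointwise_smul n x N hn, mul_ne_zero hx hn0⟩
  rw [← hstar.2.2.2 M hM]
  refine hstar.2.1 _ _ hne hle ?_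
  rw [hstar.1 x hx N hN]
  exact Submodule.smul_mem_pointwise_smul w x _ hw

theorem IsSemistar.mul_mem_of_forall_mul_mem (hstar : IsSemistar star) {M N : Submodule A K}
    (hN : N ≠ ⊥) (hM : M ≠ ⊥) {x : K} (h : ∀ w ∈ N, x * w ∈ M) {w : K} (hw : w ∈ star N) :
    x * w ∈ star M :=
  hstar.mul_mem hN (fun w hw => hstar.2.2.1 M hM (h w hw)) hM hw

theorem IsSemistar.memStarA_of_mem (hstar : IsSemistar star) {F : Submodule A K} (hF : F ≠ ⊥)
    (hfg : F.FG) {x : K} (hx : x ∈ star F) : MemStarA star F x := by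
  have h1 : (1 : Submodule A K) ≠ ⊥ :=
    (Submodule.ne_bot_iff _).mpr ⟨1, Submodule.one_le.mp le_rfl, one_ne_zero⟩
  refine ⟨F, hF, hfg, le_rfl, 1, h1, ?_, fun y hy => ?_⟩
  · rw [Submodule.one_eq_span]
    exact Submodule.fg_span_singleton 1
  · rw [mul_one]
    refine hstar.mul_mem h1 (fun w hw => ?_) hF hy
    obtain ⟨a, rfl⟩ := Submodule.mem_one.mp hw
    rw [mul_comm, ← Algebra.smul_def]
    exact Submodule.smul_mem _ a hx

theorem IsSemistar.pow_mul_mem (hstar : IsSemistar star) {F G : Submodule A K} (hF : F ≠ ⊥)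
    (hG : G ≠ ⊥) {x : K} (h : ∀ y ∈ G, x * y ∈ star (F * G)) (n : ℕ) {b : K} (hb : b ∈ G) :
    x ^ n * b ∈ star (F ^ n * G) := by
  have hne (n : ℕ) : F ^ n * G ≠ ⊥ := by
    induction n with
    | zero => simpa using hG
    | succ n ih =>
      rw [pow_succ', mul_assoc]
      exact Submodule.mul_ne_bot_of_field hF ih
  induction n with
  | zero => simpa using hstar.2.2.1 G hG hb
  | succ n ih =>
    rw [pow_succ' x, mul_assoc x]
    refine hstar.mul_mem (hne n) (fun w hw => ?_) (hne (n + 1)) ih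
    induction hw using Submodule.mul_induction_on' with
    | mem_mul_mem e he y hy =>
      rw [mul_left_comm]
      refine hstar.mul_mem_of_forall_mul_mem (Submodule.mul_ne_bot_of_field hF hG) (hne (n + 1))
        (fun w hw => ?_) (h y hy)
      rw [pow_succ F, mul_assoc (F ^ n)]
      exact Submodule.mul_mem_mul he hw
    | add u _ v _ hu hv => simpa [mul_add] using add_mem hu hv

end Semistar

section HomogFrac

variable {Γ : Type*} [AddCommMonoid Γ] [LinearOrder Γ]
variable {A : Type*} [CommRing A] {K : Type*} [Field K] [Algebra A K]
variable {𝒜 : Γ → AddSubgroup A} [GradedRing 𝒜] {V : Subring K}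

theorem mem_idealToK {I : Ideal A} {x : K} : x ∈ idealToK I ↔ ∃ a ∈ I, algebraMap A K a = x :=
  Iff.rfl

theorem IsHomogFrac.mul [IsDomain A] {E F : Submodule A K} (hE : IsHomogFrac 𝒜 E)
    (hF : IsHomogFrac 𝒜 F) : IsHomogFrac 𝒜 (E * F) := by
  obtain ⟨s, ⟨hs, α, hsα⟩, I, hI, hEI⟩ := hE
  obtain ⟨t, ⟨ht, β, htβ⟩, J, hJ, hFJ⟩ := hF
  refine ⟨s * t, ⟨mul_ne_zero hs ht, _, SetLike.GradedMul.mul_mem hsα htβ⟩, I * J, hI.mul hJ, ?_⟩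
  have : idealToK (K := K) (I * J) = idealToK I * idealToK J :=
    Submodule.map_mul I J (Algebra.ofId A K)
  rw [this, ← hEI, ← hFJ]
  refine le_antisymm ?_ (Submodule.mul_le.mpr ?_)
  · rintro _ ⟨w, hw, rfl⟩
    change algebraMap A K (s * t) * w ∈ _
    induction hw using Submodule.mul_induction_on' with
    | mem_mul_mem e he f hf =>
      rw [map_mul, mul_mul_mul_comm]
      exact Submodule.mul_mem_mul (Submodule.smul_mem_pointwise_smul _ _ _ he)
        (Submodule.smul_mem_pointwise_smul _ _ _ hf)
    | add u _ v _ hu hv => simpa [mul_add] using add_mem hu hv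
  · rintro _ ⟨e, he, rfl⟩ _ ⟨f, hf, rfl⟩
    change algebraMap A K s * e * (algebraMap A K t * f) ∈ _
    rw [mul_mul_mul_comm, ← map_mul]
    exact Submodule.smul_mem_pointwise_smul _ _ _ (Submodule.mul_mem_mul he hf)

theorem isHomogFrac_idealToK [IsDomain A] {I : Ideal A} (hI : I.IsHomogeneous 𝒜) :
    IsHomogFrac 𝒜 (idealToK (K := K) I) :=
  ⟨1, ⟨one_ne_zero, 0, SetLike.GradedOne.one_mem⟩, I, hI, by simp⟩

variable (𝒜) in
/-- The smallest homogeneous ideal containing a finite set. -/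
def homogSpan (Y : Finset A) : Ideal A :=
  Ideal.span {c | ∃ b ∈ Y, ∃ γ, c = (DirectSum.decompose 𝒜 b γ : A)}

theorem isHomogeneous_homogSpan (Y : Finset A) : (homogSpan 𝒜 Y).IsHomogeneous 𝒜 := by
  refine Ideal.homogeneous_span 𝒜 _ ?_
  rintro _ ⟨b, -, γ, rfl⟩
  exact ⟨γ, SetLike.coe_mem _⟩

theorem decompose_mem_homogSpan {Y : Finset A} {b : A} (hb : b ∈ Y) (γ : Γ) :
    (DirectSum.decompose 𝒜 b γ : A) ∈ homogSpan 𝒜 Y :=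
  Ideal.subset_span ⟨b, hb, γ, rfl⟩

theorem mem_homogSpan {Y : Finset A} {b : A} (hb : b ∈ Y) : b ∈ homogSpan 𝒜 Y := by
  classical
  rw [← DirectSum.sum_support_decompose 𝒜 b]
  exact sum_mem fun γ _ => decompose_mem_homogSpan hb γ

theorem homogSpan_fg (Y : Finset A) : (homogSpan 𝒜 Y).FG := by
  classical
  refine ⟨insert 0 (Y.biUnion fun b => (DirectSum.decompose 𝒜 b).support.image
    fun γ => (DirectSum.decompose 𝒜 b γ : A)), le_antisymm (Ideal.span_le.mpr ?_)
      (Ideal.span_le.mpr ?_)⟩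
  · intro c hc
    simp only [Finset.coe_insert, Set.mem_insert_iff, Finset.mem_coe, Finset.mem_biUnion,
      Finset.mem_image] at hc
    obtain rfl | ⟨b, hb, γ, -, rfl⟩ := hc
    exacts [zero_mem _, decompose_mem_homogSpan hb γ]
  · rintro _ ⟨b, hb, γ, rfl⟩
    refine Ideal.subset_span ?_
    by_cases h : (DirectSum.decompose 𝒜 b γ : A) = 0
    · simp [h]
    · simp only [Finset.coe_insert, Set.mem_insert_iff, Finset.mem_coe, Finset.mem_biUnion,
        Finset.mem_image]
      exact Or.inr ⟨b, hb, γ, by simpa using h, rfl⟩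

variable [IsDomain A] [IsFractionRing A K]

theorem IsGrValOverring.exists_component (hV : IsGrValOverring 𝒜 V) (Y : Finset A)
    (hY : ∃ a ∈ Y, a ≠ 0) :
    ∃ a ∈ Y, ∃ γ, (DirectSum.decompose 𝒜 a γ : A) ≠ 0 ∧ ∀ b ∈ homogSpan 𝒜 Y,
      algebraMap A K b * (algebraMap A K (DirectSum.decompose 𝒜 a γ : A))⁻¹ ∈ V := by
  classical
  obtain ⟨a, haY, ha⟩ := hY
  obtain ⟨f, hf, hmax⟩ := hV.exists_forall_div_mem
    (Y.biUnion fun b => (DirectSum.decompose 𝒜 b).support.image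
      fun γ => algebraMap A K (DirectSum.decompose 𝒜 b γ : A))
    (by
      obtain ⟨γ, hγ⟩ : ∃ γ, (DirectSum.decompose 𝒜 a γ : A) ≠ 0 := by
        by_contra! hall
        exact ha (by
          rw [← DirectSum.sum_support_decompose 𝒜 a]
          exact Finset.sum_eq_zero fun i _ => hall i)
      exact ⟨_, Finset.mem_biUnion.mpr ⟨a, haY, Finset.mem_image_of_mem _ (by simpa using hγ)⟩⟩)
    (by
      intro x hx
      obtain ⟨b, -, hx⟩ := Finset.mem_biUnion.mp hx
      obtain ⟨γ, hγ, rfl⟩ := Finset.mem_image.mp hx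
      exact ⟨_, 1, ⟨by simpa using hγ, γ, SetLike.coe_mem _⟩,
        ⟨one_ne_zero, 0, SetLike.GradedOne.one_mem⟩, by simp⟩)
  obtain ⟨a, ha, hf⟩ := Finset.mem_biUnion.mp hf
  obtain ⟨γ, hγ, rfl⟩ := Finset.mem_image.mp hf
  refine ⟨a, ha, γ, by simpa using hγ, fun b hb => ?_⟩
  induction hb using Submodule.span_induction with
  | mem c hc =>
    obtain ⟨b, hb, δ, rfl⟩ := hc
    by_cases h : (DirectSum.decompose 𝒜 b δ : A) = 0
    · simp [h, zero_mem]
    · exact hmax _ (Finset.mem_biUnion.mpr ⟨b, hb, Finset.mem_image_of_mem _ (by simpa using h)⟩)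
  | zero => simp [zero_mem]
  | add x y _ _ hx hy => simpa [add_mul] using add_mem hx hy
  | smul r x _ hx =>
    rw [smul_eq_mul, map_mul, mul_assoc]
    exact mul_mem (hV.1.1 r) hx

/-- A finitely generated homogeneous fractional ideal becomes principal in a gr-valuation
overring. -/
theorem IsGrValOverring.exists_generator (hV : IsGrValOverring 𝒜 V) {F : Submodule A K}
    (hF : F ≠ ⊥) (hfg : F.FG) (hhom : IsHomogFrac 𝒜 F) :
    ∃ f ∈ F, f ≠ 0 ∧ ∀ x ∈ F, x * f⁻¹ ∈ V := by
  obtain ⟨s, ⟨hs, -⟩, I, hI, hFI⟩ := hhom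
  have hinj := IsFractionRing.injective A K
  have hs' : algebraMap A K s ≠ 0 := (map_ne_zero_iff _ hinj).mpr hs
  have hIfg : I.FG := by
    refine Submodule.fg_of_fg_map_injective (Algebra.linearMap A K) hinj ?_
    change (idealToK I).FG
    rw [← hFI]
    exact hfg.map _
  obtain ⟨Y, hY⟩ := hIfg
  obtain ⟨x, hx, hx0⟩ := F.ne_bot_iff.mp hF
  have hmem {x : K} (hx : x ∈ F) : ∃ a ∈ I, algebraMap A K a = algebraMap A K s * x :=
    mem_idealToK.mp (hFI ▸ Submodule.smul_mem_pointwise_smul x (algebraMap A K s) F hx)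
  have hY0 : ∃ a ∈ Y, a ≠ 0 := by
    by_contra! hall
    obtain ⟨a, ha, hax⟩ := hmem hx
    have : I = ⊥ := by
      rw [← hY]
      exact Submodule.span_eq_bot.mpr hall
    rw [this, Submodule.mem_bot] at ha
    rw [ha, map_zero] at hax
    exact mul_ne_zero hs' hx0 hax.symm
  obtain ⟨a, ha, γ, haγ, hmax⟩ := hV.exists_component Y hY0
  have haI : (DirectSum.decompose 𝒜 a γ : A) ∈ I := hI γ (hY ▸ Submodule.subset_span ha)
  have haF : algebraMap A K (DirectSum.decompose 𝒜 a γ : A) ∈ algebraMap A K s • F :=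
    hFI ▸ mem_idealToK.mpr ⟨_, haI, rfl⟩
  obtain ⟨f, hf, hfa⟩ := haF
  replace hfa : algebraMap A K s * f = algebraMap A K (DirectSum.decompose 𝒜 a γ : A) := hfa
  have hf0 : f ≠ 0 := by
    rintro rfl
    rw [mul_zero] at hfa
    exact (map_ne_zero_iff _ hinj).mpr haγ hfa.symm
  refine ⟨f, hf, hf0, fun x hx => ?_⟩
  obtain ⟨b, hb, hbx⟩ := hmem hx
  have hIle : I ≤ homogSpan 𝒜 Y := by
    rw [← hY]
    exact Submodule.span_le.mpr fun b hb => mem_homogSpan hb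
  convert hmax b (hIle hb) using 1
  rw [hbx, ← hfa]
  field_simp

end HomogFrac

section Closure

variable {Γ : Type*} [AddCommMonoid Γ] [LinearOrder Γ]
variable {A : Type*} [CommRing A] {K : Type*} [Field K] [Algebra A K]
variable {𝒜 : Γ → AddSubgroup A} [GradedRing 𝒜] {V : Subring K}

theorem coeff_gradedToGroupAlgebra_eq_zero {G : Type*} [AddCommGroup G] (ι : Γ →+ G) (a : A)
    {g : G} (hg : g ∉ Set.range ι) : (gradedToGroupAlgebra 𝒜 ι K a).coeff g = 0 := by
  induction a using DirectSum.Decomposition.inductionOn 𝒜 with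
  | zero => simp
  | @homogeneous i a =>
    rw [gradedToGroupAlgebra_of_mem 𝒜 ι a.2, coeff_single]
    exact Finsupp.single_eq_of_ne fun h => hg ⟨i, h.symm⟩
  | add a b ha hb => simp [ha, hb]

variable [IsDomain A] [IsFractionRing A K]

/-- A gr-valuation overring is completely integrally closed with respect to multipliers `a / a_γ`,
where `a_γ` is a homogeneous component of `a` of least value. -/
theorem IsGrValOverring.mem_of_forall_pow_mul_mem {G : Type*} [AddCommGroup G] [UniqueSums G]
    [IsAddTorsionFree G] {ι : Γ →+ G} (hι : Function.Injective ι) (hV : IsGrValOverring 𝒜 V)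
    {a : A} {γ : Γ} (haγ : (DirectSum.decompose 𝒜 a γ : A) ≠ 0)
    (hmax : ∀ δ, algebraMap A K (DirectSum.decompose 𝒜 a δ : A) *
      (algebraMap A K (DirectSum.decompose 𝒜 a γ : A))⁻¹ ∈ V) {y : K}
    (h : ∀ n : ℕ, y ^ n * (algebraMap A K a *
      (algebraMap A K (DirectSum.decompose 𝒜 a γ : A))⁻¹) ∈ V) : y ∈ V := by
  have hinj := IsFractionRing.injective A K
  have ha0 : a ≠ 0 := by
    rintro rfl
    simp at haγ
  set g := algebraMap A K (DirectSum.decompose 𝒜 a γ : A) with hg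
  have hg0 : g ≠ 0 := (map_ne_zero_iff _ hinj).mpr haγ
  have hc : algebraMap A K a * g⁻¹ ≠ 0 :=
    mul_ne_zero ((map_ne_zero_iff _ hinj).mpr ha0) (inv_ne_zero hg0)
  obtain ⟨z, hz, rfl⟩ := exists_mem_augmentation_eq_of_forall_pow_mul 𝒜 ι hι hc
    fun n => hV.1.2.1 _ (h n)
  set u := single (-ι γ) g⁻¹ * gradedToGroupAlgebra 𝒜 ι K a with hu
  have hsingle : single (ι γ) g ∈ homogeneousLocalizationImage 𝒜 ι K := by
    rw [hg, ← gradedToGroupAlgebra_of_mem 𝒜 ι (SetLike.coe_mem _)]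
    exact gradedToGroupAlgebra_mem 𝒜 ι _
  have huT : u ∈ homogeneousLocalizationImage 𝒜 ι K :=
    mul_mem (isHomogElem_of_single_mem 𝒜 ι hι hg0 hsingle).2 (gradedToGroupAlgebra_mem 𝒜 ι a)
  have huc (k : G) : u.coeff k = g⁻¹ * (gradedToGroupAlgebra 𝒜 ι K a).coeff (ι γ + k) := by
    rw [hu, coeff_single_mul_apply, neg_neg]
  have huV (k : G) : u.coeff k ∈ V := by
    rw [huc]
    by_cases hk : ι γ + k ∈ Set.range ι
    · obtain ⟨δ, hδ⟩ := hk
      rw [← hδ, coeff_gradedToGroupAlgebra 𝒜 ι hι, mul_comm]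
      exact hmax δ
    · rw [coeff_gradedToGroupAlgebra_eq_zero ι a hk, mul_zero]
      exact zero_mem V
  have hu1 : u.coeff 0 = 1 := by
    rw [huc, add_zero, coeff_gradedToGroupAlgebra 𝒜 ι hι, inv_mul_cancel₀ hg0]
  obtain ⟨w, hw, hwV, hwe⟩ := hV.exists_coeff_mem (ι := ι) (h 1)
  have huz : u * z = w := by
    refine eq_of_augmentation_eq 𝒜 ι (mul_mem huT hz) hw ?_
    rw [hwe, hu, map_mul, map_mul, augmentation_single, augmentation_gradedToGroupAlgebra]
    ring
  exact augmentation_mem (hV.coeff_mem_of_mul_coeff_mem hι huT hz huV ⟨0, hu1⟩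
    fun k => huz ▸ hwV k)

theorem exists_injective_addMonoidHom_addCommGroup.{u} (Γ : Type u) [AddCommMonoid Γ]
    [LinearOrder Γ] [CovariantClass Γ Γ (· + ·) (· < ·)] :
    ∃ (G : Type u) (_ : AddCommGroup G) (_ : UniqueSums G) (_ : IsAddTorsionFree G) (ι : Γ →+ G),
      Function.Injective ι := by
  have : IsOrderedCancelAddMonoid Γ :=
    { add_le_add_left := fun a b hab c => by
        rcases hab.eq_or_lt with rfl | hlt
        · rfl
        · rw [add_comm a, add_comm b]
          exact (CovariantClass.elim c hlt).le
      le_of_add_le_add_left := fun a b c hbc => by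
        by_contra! hlt
        exact hbc.not_gt (CovariantClass.elim a hlt) }
  refine ⟨Algebra.GrothendieckAddGroup Γ, inferInstance, ?_, ?_,
    Algebra.GrothendieckAddGroup.of, ?_⟩
  · infer_instance
  · infer_instance
  · intro a b hab
    obtain ⟨c, hc⟩ := (AddLocalization.addMonoidOf (⊤ : AddSubmonoid Γ)).eq_iff_exists.mp hab
    exact add_left_cancel hc

theorem IsGrValOverring.mem_mulSet_of_memStarA [CovariantClass Γ Γ (· + ·) (· < ·)]
    {star : Submodule A K → Submodule A K} (hstar : IsSemistar star)
    (hV : IsGrValOverring 𝒜 V) (hVstar : IsGrStarValOverring 𝒜 star V) {F : Submodule A K}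
    (hF : F ≠ ⊥) (hfg : F.FG) (hhom : IsHomogFrac 𝒜 F) {x : K} (hx : MemStarA star F x) :
    x ∈ mulSet F (V : Set K) := by
  classical
  have hinj := IsFractionRing.injective A K
  obtain ⟨f, hfF, hf0, hfmax⟩ := hV.exists_generator hF hfg hhom
  obtain ⟨F', hF', -, hle, G, hG, ⟨X, hX⟩, hxG⟩ := hx
  have hxG' (y : K) (hy : y ∈ G) : x * y ∈ star (F * G) :=
    hstar.2.1 _ _ (Submodule.mul_ne_bot_of_field hF' hG) (mul_le_mul_left hle G)
      (hxG y (hstar.2.2.1 G hG hy))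
  obtain ⟨d, hd⟩ := IsLocalization.exist_integer_multiples_of_finset (nonZeroDivisors A) X
  have hd0 : algebraMap A K d ≠ 0 :=
    (map_ne_zero_iff _ hinj).mpr (nonZeroDivisors.ne_zero d.2)
  choose r hr using hd
  let Y : Finset A := X.attach.image fun b => r b.1 b.2
  have hrd (b : K) (hb : b ∈ X) : algebraMap A K (r b hb) = algebraMap A K d * b := by
    rw [hr b hb, ← Algebra.smul_def]
  have hrY (b : K) (hb : b ∈ X) : r b hb ∈ Y :=
    Finset.mem_image.mpr ⟨⟨b, hb⟩, Finset.mem_attach _ _, rfl⟩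
  have hY0 : ∃ a ∈ Y, a ≠ 0 := by
    obtain ⟨b, hb, hb0⟩ : ∃ b ∈ X, b ≠ 0 := by
      by_contra! hall
      exact hG (hX ▸ Submodule.span_eq_bot.mpr hall)
    refine ⟨r b hb, hrY b hb, fun h0 => ?_⟩
    have := hrd b hb
    rw [h0, map_zero] at this
    exact mul_ne_zero hd0 hb0 this.symm
  obtain ⟨a, haY, γ, haγ, hmax⟩ := hV.exists_component Y hY0
  set g := algebraMap A K (DirectSum.decompose 𝒜 a γ : A)
  have hg0 : g ≠ 0 := (map_ne_zero_iff _ hinj).mpr haγ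
  set J : Submodule A K := idealToK (homogSpan 𝒜 Y)
  have hdG (b : K) (hb : b ∈ G) : algebraMap A K d * b ∈ J := by
    rw [← hX] at hb
    induction hb using Submodule.span_induction with
    | mem b hb => exact mem_idealToK.mpr ⟨r b hb, mem_homogSpan (hrY b hb), hrd b hb⟩
    | zero => simp
    | add b c _ _ hb hc => simpa [mul_add] using add_mem hb hc
    | smul t b _ hb =>
      rw [mul_smul_comm]
      exact Submodule.smul_mem _ t hb
  have hJ0 : J ≠ ⊥ := (Submodule.ne_bot_iff _).mpr
    ⟨g, mem_idealToK.mpr ⟨_, decompose_mem_homogSpan haY γ, rfl⟩, hg0⟩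
  have hprod (n : ℕ) : F ^ n * J ≠ ⊥ ∧ (F ^ n * J).FG ∧ IsHomogFrac 𝒜 (F ^ n * J) ∧
      ∀ e ∈ F ^ n * J, e * (f ^ n * g)⁻¹ ∈ V := by
    induction n with
    | zero =>
      rw [pow_zero F, one_mul J, pow_zero, one_mul]
      refine ⟨hJ0, Submodule.FG.map _ (homogSpan_fg Y),
        isHomogFrac_idealToK (isHomogeneous_homogSpan Y), ?_⟩
      intro e he
      obtain ⟨b, hb, rfl⟩ := mem_idealToK.mp he
      exact hmax b hb
    | succ n ih =>
      rw [pow_succ' F, mul_assoc F]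
      refine ⟨Submodule.mul_ne_bot_of_field hF ih.1, hfg.mul ih.2.1, hhom.mul ih.2.2.1, ?_⟩
      intro e he
      induction he using Submodule.mul_induction_on' with
      | mem_mul_mem e he w hw =>
        convert mul_mem (hfmax e he) (ih.2.2.2 w hw) using 1
        rw [pow_succ' f]
        field_simp
      | add u _ v _ hu hv => simpa [add_mul] using add_mem hu hv
  have hFG (n : ℕ) : F ^ n * G ≠ ⊥ := by
    induction n with
    | zero => simpa using hG
    | succ n ih =>
      rw [pow_succ' F, mul_assoc F]
      exact Submodule.mul_ne_bot_of_field hF ih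
  obtain ⟨b, hbX, hba⟩ : ∃ b, ∃ hb : b ∈ X, r b hb = a := by
    obtain ⟨b, -, hb⟩ := Finset.mem_image.mp haY
    exact ⟨b.1, b.2, hb⟩
  have hab : algebraMap A K a = algebraMap A K d * b := hba ▸ hrd b hbX
  have hpow (n : ℕ) : (x * f⁻¹) ^ n * (algebraMap A K a * g⁻¹) ∈ V := by
    obtain ⟨hne, hfgn, hhomn, hbound⟩ := hprod n
    have hmem : algebraMap A K d * (x ^ n * b) ∈ star (F ^ n * J) := by
      refine hstar.mul_mem_of_forall_mul_mem (hFG n) hne (fun w hw => ?_)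
        (hstar.pow_mul_mem hF hG hxG' n (hX ▸ Submodule.subset_span hbX))
      induction hw using Submodule.mul_induction_on' with
      | mem_mul_mem e he w hw =>
        rw [mul_left_comm]
        exact Submodule.mul_mem_mul he (hdG w hw)
      | add u _ v _ hu hv => simpa [mul_add] using add_mem hu hv
    convert mem_mulSet_mul_mem hV.1.1 hbound (hVstar _ hne hfgn hhomn hmem) using 1
    rw [hab, mul_pow, mul_inv, inv_pow]
    ring
  obtain ⟨G', _, _, _, ι, hι⟩ := exists_injective_addMonoidHom_addCommGroup Γ
  have hy : x * f⁻¹ ∈ V := hV.mem_of_forall_pow_mul_mem hι haγ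
    (fun δ => hmax _ (decompose_mem_homogSpan haY δ)) hpow
  have := mul_mem_mulSet hfF hy
  rwa [mul_left_comm, mul_inv_cancel₀ hf0, mul_one] at this

end Closure

/-- Let `⋆` be a homogeneous preserving semistar operation on the graded
domain `R` and `V` a gr-valuation overring of `R`. Then `V` is a gr-`⋆`-valuation overring
of `R` iff `V` is a gr-`⋆_a`-valuation overring of `R`. -/
theorem grStarVal_iff_grStarAVal
    {Γ : Type*} [AddCommMonoid Γ] [LinearOrder Γ]
    [CovariantClass Γ Γ (· + ·) (· < ·)] [Nontrivial Γ]
    {A : Type*} [CommRing A] [IsDomain A]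
    {K : Type*} [Field K] [Algebra A K] [IsFractionRing A K]
    (𝒜 : Γ → AddSubgroup A) [GradedRing 𝒜]
    (star stara : Submodule A K → Submodule A K)
    (hstar : IsSemistar star) (hhp : HomogPres 𝒜 star)
    (ha : ∀ E : Submodule A K, E ≠ ⊥ → ∀ x : K, x ∈ stara E ↔ MemStarA star E x)
    (V : Subring K) (hV : IsGrValOverring 𝒜 V) :
    IsGrStarValOverring 𝒜 star V ↔ IsGrStarValOverring 𝒜 stara V := by
  constructor
  · intro h F hF hfg hhom x hx
    exact hV.mem_mulSet_of_memStarA hstar h hF hfg hhom ((ha F hF x).mp hx)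
  · intro h F hF hfg hhom x hx
    exact h F hF hfg hhom ((ha F hF x).mpr (hstar.memStarA_of_mem hF hfg hx))
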